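/- (Packing lemma) There is an absolute constant C > 1 such that the following holds for every positive integer t and every m. If G is a 3-partite finite simple graph on vertex sets X, Y, Z of equal size m, and the three edge densities d(X,Y), d(X,Z), d(Y,Z) are all at least 15/16, then G contains at least ⌊m^{3t}/C^{3t²}⌋ distinct copies of K_{t,t,t}, i.e., at least that many triples (S,T,U) of t-element subsets S ⊆ X, T ⊆ Y, U ⊆ Z such that every pair of vertices from two distinct sets among S, T, U is an edge of G. -/

import Mathlib

lemma aux_choose (n k : ℕ) (x : ℝ) (hk : 0 < k) (hx : (2:ℝ)^k ≤ x) (hn : x ≤ n) :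
    (x / 2^k)^k ≤ (n.choose k : ℝ) := by
  have h2 : 2 * k ≤ 2^k := by
    clear hx
    induction k, hk using Nat.le_induction with
    | base => norm_num
    | succ j hj ih => have : 2 ≤ 2^j := by
                        calc 2 = 2^1 := by norm_num
                          _ ≤ 2^j := Nat.pow_le_pow_right (by norm_num) hj
                      rw [pow_succ]; omega
  have h2' : (2:ℝ) * k ≤ 2^k := by exact_mod_cast h2
  have hkn : k ≤ n := by
    have : (k:ℝ) ≤ n := by have : (0:ℝ) ≤ k := by positivity
                           linarith
    exact_mod_cast this
  have hx0 : 0 ≤ x := le_trans (by positivity) hx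
  have hkpos : (0:ℝ) < k := by exact_mod_cast hk
  have hc : (n:ℝ) / 2 ≤ ((n + 1 - k : ℕ) : ℝ) := by
    rw [Nat.cast_sub (by omega)]
    push_cast
    linarith
  have hb : x / 2^k ≤ ((n + 1 - k : ℕ) : ℝ)/k := by
    calc x / 2^k ≤ (n:ℝ) / (2 * k) := div_le_div₀ (by positivity) hn (by positivity) h2'
      _ = ((n:ℝ)/2)/k := by field_simp
      _ ≤ _ := by gcongr
  calc (x / 2^k)^k ≤ (((n + 1 - k : ℕ) : ℝ)/k)^k := by gcongr
    _ = ((n + 1 - k : ℕ) : ℝ)^k/(k:ℝ)^k := by rw [div_pow]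
    _ ≤ ((n + 1 - k : ℕ) : ℝ)^k/(k.factorial : ℝ) := by
        gcongr
        exact_mod_cast Nat.factorial_le_pow k
    _ ≤ n.choose k := Nat.pow_le_choose k n

lemma aux_markov {β : Type} (W : Finset β) (f : β → ℕ) (a M : ℝ)
    (h : ∑ w ∈ W, (f w : ℝ) ≤ M) :
    ((W.filter (fun w => a < f w)).card : ℝ) * a ≤ M := by
  refine le_trans ?_ h
  calc ((W.filter (fun w => a < f w)).card : ℝ) * a = ∑ w ∈ W.filter (fun w => a < f w), a := by simp
    _ ≤ ∑ w ∈ W.filter (fun w => a < f w), (f w:ℝ) := Finset.sum_le_sum (fun w hw => (Finset.mem_filter.1 hw).2.le)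
    _ ≤ _ := Finset.sum_le_sum_of_subset_of_nonneg (Finset.filter_subset _ _) (by intros; positivity)

open Classical in
lemma aux_dens {β : Type} (G : SimpleGraph β) [DecidableRel G.Adj] (X Y : Finset β) (m : ℕ)
    (hm : 0 < m) (hX : X.card = m) (hY : Y.card = m)
    (h : (15 / 16 : ℝ) ≤ (G.edgeDensity X Y : ℝ)) :
    ((X.filter (fun x => (m:ℝ)/4 < ((Y.filter (fun y => ¬ G.Adj x y)).card : ℕ))).card : ℝ) ≤ m/4 := by
  have hm' : (0:ℝ) < m := by exact_mod_cast hm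
  have key : ∑ x ∈ X, ((Y.filter (fun y => ¬ G.Adj x y)).card : ℝ) ≤ (m:ℝ)^2/16 := by
    have h1 : (G.interedges X Y).card = ∑ x ∈ X, (Y.filter (fun y => G.Adj x y)).card := by
      simp only [SimpleGraph.interedges, Rel.interedges]
      rw [Finset.card_filter, Finset.sum_product]
      simp only [Finset.card_filter]
    have h2 : (15/16:ℝ) * m^2 ≤ (G.interedges X Y).card := by
      rw [SimpleGraph.edgeDensity_def] at h
      push_cast at h
      rw [hX, hY, le_div_iff₀ (by positivity)] at h
      linarith [sq (m:ℝ)]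
    have h3 : ∑ x ∈ X, (((Y.filter (fun y => G.Adj x y)).card : ℝ) + ((Y.filter (fun y => ¬ G.Adj x y)).card : ℝ)) = (m:ℝ)^2 := by
      have : ∀ x ∈ X, (((Y.filter (fun y => G.Adj x y)).card : ℝ) + ((Y.filter (fun y => ¬ G.Adj x y)).card : ℝ)) = m := by
        intro x _
        have := Finset.card_filter_add_card_filter_not (s := Y) (fun y => G.Adj x y)
        rw [hY] at this
        exact_mod_cast this
      rw [Finset.sum_congr rfl this]
      simp [hX, sq]
    rw [Finset.sum_add_distrib] at h3
    rw [h1] at h2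
    push_cast at h2
    linarith
  have := aux_markov X (fun x => (Y.filter (fun y => ¬ G.Adj x y)).card) ((m:ℝ)/4) _ key
  nlinarith

open Classical in
lemma aux_half {β : Type} (R : β → β → Prop) (A W : Finset β) (s : ℕ) (μ : ℝ) (hs : 0 < s)
    (hA : A.card = 4 * s)
    (h : ∀ a ∈ A, ((W.filter (fun w => ¬ R a w)).card : ℝ) ≤ μ) :
    ((W.filter (fun w => (A.filter (fun a => R a w)).card < s)).card : ℝ) ≤ 4/3 * μ := by
  have hs' : (0:ℝ) < s := by exact_mod_cast hs
  have h1 : ∑ w ∈ W, ((A.filter (fun a => ¬ R a w)).card : ℝ) ≤ 4 * s * μ := by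
    have : ∑ w ∈ W, (A.filter (fun a => ¬ R a w)).card = ∑ a ∈ A, (W.filter (fun w => ¬ R a w)).card := by
      simp only [Finset.card_filter]
      exact Finset.sum_comm
    have h' : ∑ w ∈ W, ((A.filter (fun a => ¬ R a w)).card:ℝ) = ∑ a ∈ A, ((W.filter (fun w => ¬ R a w)).card : ℝ) := by
      exact_mod_cast this
    rw [h']
    calc _ ≤ ∑ a ∈ A, μ := Finset.sum_le_sum h
      _ = _ := by simp [hA]
  have h2 := aux_markov W (fun w => (A.filter (fun a => ¬ R a w)).card) (3*s) _ h1
  have h3 : (W.filter (fun w => (A.filter (fun a => R a w)).card < s)).card ≤ (W.filter (fun w => (3*s:ℝ) < ((A.filter (fun a => ¬ R a w)).card : ℕ))).card := by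
    apply Finset.card_le_card
    intro w hw
    rw [Finset.mem_filter] at hw ⊢
    refine ⟨hw.1, ?_⟩
    have := Finset.card_filter_add_card_filter_not (s := A) (fun a => R a w)
    have h4 : 3 * s < (A.filter (fun a => ¬ R a w)).card := by omega
    exact_mod_cast h4
  have h3' : ((W.filter (fun w => (A.filter (fun a => R a w)).card < s)).card:ℝ) ≤ (W.filter (fun w => (3*s:ℝ) < ((A.filter (fun a => ¬ R a w)).card : ℕ))).card := by exact_mod_cast h3
  have h5 : ((W.filter (fun w => (3*s:ℝ) < ((A.filter (fun a => ¬ R a w)).card : ℕ))).card:ℝ) ≤ 4/3*μ := by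
    by_contra hc
    push Not at hc
    nlinarith
  linarith

open Classical in
lemma aux_pig {β γ : Type} (W : Finset β) (K : Finset γ) (P : β → γ → Prop) (x : ℝ) (hx : 0 < x)
    (hW : (K.card:ℝ) * x ≤ W.card) (hK : K.Nonempty) (h : ∀ w ∈ W, ∃ k ∈ K, P w k) :
    ∃ k ∈ K, (x ≤ ((W.filter (fun w => P w k)).card : ℝ)) := by
  have hne : Nonempty γ := ⟨hK.choose⟩
  choose! f hf hP using h
  obtain ⟨k, hk, hk2⟩ := Finset.exists_le_card_fiber_of_nsmul_le_card_of_maps_to (M := ℝ) (b := x) hf hK (by simpa using hW)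
  refine ⟨k, hk, hk2.trans ?_⟩
  norm_cast
  apply Finset.card_le_card
  intro w hw
  rw [Finset.mem_filter] at hw ⊢
  exact ⟨hw.1, hw.2 ▸ hP w hw.1⟩

open Classical in
lemma aux_stepA {β : Type} (R : β → β → Prop) (A W : Finset β) (t m : ℕ) (ht : 0 < t) (hm : 0 < m)
    (hA : A.card = 16 * t) (hW : (3/4:ℝ) * m ≤ W.card)
    (h : ∀ a ∈ A, ((W.filter (fun w => ¬ R a w)).card : ℝ) ≤ m/4) :
    ∃ S ⊆ A, S.card = 4 * t ∧ (m:ℝ)/2^(18*t) ≤ ((W.filter (fun w => ∀ a ∈ S, R a w)).card : ℝ) := by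
  have hm' : (0:ℝ) < m := by exact_mod_cast hm
  have h1 := aux_half R A W (4*t) (m/4) (by omega) (by omega) h
  have h2 := Finset.card_filter_add_card_filter_not (s := W) (fun w => (A.filter (fun a => R a w)).card < 4*t)
  have h2' : ((W.filter (fun w => (A.filter (fun a => R a w)).card < 4*t)).card:ℝ) + ((W.filter (fun w => ¬ (A.filter (fun a => R a w)).card < 4*t)).card:ℝ) = W.card := by exact_mod_cast h2
  obtain ⟨S, hS, hS2⟩ := aux_pig (W.filter (fun w => ¬ (A.filter (fun a => R a w)).card < 4*t)) (A.powersetCard (4*t))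
    (fun w S => ∀ a ∈ S, R a w) ((m:ℝ)/2^(18*t)) (by positivity) (by
      have e1 : ((A.powersetCard (4*t)).card:ℝ) ≤ 2^(16*t) := by
        rw [Finset.card_powersetCard, hA]
        exact_mod_cast Nat.choose_le_two_pow _ _
      have e2 : (2:ℝ)^(16*t) * (m/2^(18*t)) ≤ m/4 := by
        have : (2:ℝ)^(18*t) = 2^(16*t) * 2^(2*t) := by rw [← pow_add]; congr 1; ring
        rw [this]
        have e3 : (4:ℝ) ≤ 2^(2*t) := by
          calc (4:ℝ) = 2^2 := by norm_num
            _ ≤ 2^(2*t) := pow_le_pow_right₀ (by norm_num) (by omega)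
        calc (2:ℝ)^(16*t) * (m/(2^(16*t) * 2^(2*t))) = m/2^(2*t) := by field_simp
          _ ≤ m/4 := by gcongr
      calc _ ≤ (2:ℝ)^(16*t) * (m/2^(18*t)) := by gcongr
        _ ≤ _ := by linarith)
    (by apply Finset.powersetCard_nonempty.2; omega)
    (by
      intro w hw
      rw [Finset.mem_filter, not_lt] at hw
      obtain ⟨S, hS, hc⟩ := Finset.exists_subset_card_eq hw.2
      exact ⟨S, Finset.mem_powersetCard.2 ⟨hS.trans (Finset.filter_subset _ _), hc⟩, fun a ha => (Finset.mem_filter.1 (hS ha)).2⟩)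
  rw [Finset.mem_powersetCard] at hS
  refine ⟨S, hS.1, hS.2, hS2.trans ?_⟩
  norm_cast
  apply Finset.card_le_card
  intro w hw
  simp only [Finset.mem_filter, Finset.mem_sdiff] at hw ⊢
  exact ⟨hw.1.1, hw.2⟩

open Classical in
lemma aux_stepB {β : Type} (R : β → β → Prop) (A B W : Finset β) (t m : ℕ) (ht : 0 < t) (hm : 0 < m)
    (hA : A.card = 4 * t) (hB : B.card = 4 * t) (hW : W.card = m)
    (h : ∀ a ∈ A, ((W.filter (fun w => ¬ R a w)).card : ℝ) ≤ m/4)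
    (h' : ∀ a ∈ B, ((W.filter (fun w => ¬ R a w)).card : ℝ) ≤ m/4) :
    ∃ p : Finset β × Finset β, p.1 ⊆ A ∧ p.2 ⊆ B ∧ p.1.card = t ∧ p.2.card = t ∧
      (m:ℝ)/2^(10*t) ≤ ((W.filter (fun w => (∀ a ∈ p.1, R a w) ∧ ∀ a ∈ p.2, R a w)).card : ℝ) := by
  have hm' : (0:ℝ) < m := by exact_mod_cast hm
  have h1 := aux_half R A W t (m/4) ht hA h
  have h1' := aux_half R B W t (m/4) ht hB h'
  set W1 := W.filter (fun w => (A.filter (fun a => R a w)).card < t) with hW1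
  set W2 := W.filter (fun w => (B.filter (fun a => R a w)).card < t) with hW2
  have h3 : W.card ≤ (W \ (W1 ∪ W2)).card + (W1.card + W2.card) := by
    have := Finset.le_card_sdiff (W1 ∪ W2) W
    have := Finset.card_union_le W1 W2
    omega
  have h3' : (W.card:ℝ) ≤ (W \ (W1 ∪ W2)).card + (W1.card + W2.card) := by exact_mod_cast h3
  rw [hW] at h3'
  obtain ⟨S, hS, hS2⟩ := aux_pig (W \ (W1 ∪ W2)) (A.powersetCard t ×ˢ B.powersetCard t)
    (fun w p => (∀ a ∈ p.1, R a w) ∧ ∀ a ∈ p.2, R a w) ((m:ℝ)/2^(10*t)) (by positivity) (by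
      have e1 : ((A.powersetCard t ×ˢ B.powersetCard t).card:ℝ) ≤ 2^(8*t) := by
        rw [Finset.card_product, Finset.card_powersetCard, Finset.card_powersetCard, hA, hB]
        have : (8*t) = 4*t+4*t := by ring
        rw [this, pow_add]
        exact_mod_cast Nat.mul_le_mul (Nat.choose_le_two_pow _ _) (Nat.choose_le_two_pow _ _)
      have e2 : (2:ℝ)^(8*t) * (m/2^(10*t)) ≤ m/4 := by
        have : (2:ℝ)^(10*t) = 2^(8*t) * 2^(2*t) := by rw [← pow_add]; congr 1; ring
        rw [this]
        have e3 : (4:ℝ) ≤ 2^(2*t) := by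
          calc (4:ℝ) = 2^2 := by norm_num
            _ ≤ 2^(2*t) := pow_le_pow_right₀ (by norm_num) (by omega)
        calc (2:ℝ)^(8*t) * (m/(2^(8*t) * 2^(2*t))) = m/2^(2*t) := by field_simp
          _ ≤ m/4 := by gcongr
      calc _ ≤ (2:ℝ)^(8*t) * (m/2^(10*t)) := by gcongr
        _ ≤ _ := by linarith)
    (by apply Finset.Nonempty.product <;> (apply Finset.powersetCard_nonempty.2; omega))
    (by
      intro w hw
      rw [Finset.mem_sdiff, Finset.mem_union, not_or, hW1, hW2, Finset.mem_filter, Finset.mem_filter] at hw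
      obtain ⟨hw, ha, hb⟩ := hw
      have ha' : t ≤ (A.filter (fun a => R a w)).card := by by_contra hc; exact ha ⟨hw, by omega⟩
      have hb' : t ≤ (B.filter (fun a => R a w)).card := by by_contra hc; exact hb ⟨hw, by omega⟩
      obtain ⟨S, hS, hc⟩ := Finset.exists_subset_card_eq ha'
      obtain ⟨T, hT, hd⟩ := Finset.exists_subset_card_eq hb'
      exact ⟨(S, T), Finset.mem_product.2 ⟨Finset.mem_powersetCard.2 ⟨hS.trans (Finset.filter_subset _ _), hc⟩,
        Finset.mem_powersetCard.2 ⟨hT.trans (Finset.filter_subset _ _), hd⟩⟩,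
        fun a ha => (Finset.mem_filter.1 (hS ha)).2, fun a ha => (Finset.mem_filter.1 (hT ha)).2⟩)
  rw [Finset.mem_product, Finset.mem_powersetCard, Finset.mem_powersetCard] at hS
  refine ⟨S, hS.1.1, hS.2.1, hS.1.2, hS.2.2, hS2.trans ?_⟩
  norm_cast
  apply Finset.card_le_card
  intro w hw
  simp only [Finset.mem_filter, Finset.mem_sdiff] at hw ⊢
  exact ⟨hw.1.1, hw.2⟩

lemma aux_arith (N m t : ℕ) (ht : 0 < t) (hm : 0 < m)
    (h : ((m:ℝ)/2/2^(16*t))^(16*t) * (((m:ℝ)/2^(18*t)/2^(4*t))^(4*t) * ((m:ℝ)/2^(10*t)/2^t)^t)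
      ≤ N * ((m:ℝ)^(15*t) * (m:ℝ)^(3*t))) :
    (m:ℝ)^(3*t) / ((2:ℝ)^124)^(3*t^2) ≤ N := by
  have hm' : (0:ℝ) < m := by exact_mod_cast hm
  have e1 : (m:ℝ)/2^(17*t) ≤ (m:ℝ)/2/2^(16*t) := by
    rw [div_div, ← pow_succ']
    apply div_le_div_of_nonneg_left hm'.le (by positivity)
    exact pow_le_pow_right₀ (by norm_num) (by omega)
  have e2 : (m:ℝ)/2^(18*t)/2^(4*t) = (m:ℝ)/2^(22*t) := by
    rw [div_div, ← pow_add]; congr 2; ring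
  have e3 : (m:ℝ)/2^(10*t)/2^t = (m:ℝ)/2^(11*t) := by
    rw [div_div, ← pow_add]; congr 2; ring
  rw [e2, e3] at h
  have h1 : ((m:ℝ)/2^(17*t))^(16*t) * (((m:ℝ)/2^(22*t))^(4*t) * ((m:ℝ)/2^(11*t))^t)
      ≤ N * ((m:ℝ)^(15*t) * (m:ℝ)^(3*t)) := le_trans (by gcongr) h
  have h2 : ((m:ℝ)/2^(17*t))^(16*t) * (((m:ℝ)/2^(22*t))^(4*t) * ((m:ℝ)/2^(11*t))^t)
      = ((m:ℝ)^(3*t) / 2^(371*t^2)) * ((m:ℝ)^(15*t) * (m:ℝ)^(3*t)) := by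
    simp only [div_pow, ← pow_mul]
    rw [div_mul_div_comm, div_mul_div_comm, div_mul_eq_mul_div, ← pow_add, ← pow_add, ← pow_add, ← pow_add, ← pow_add, ← pow_add]
    congr 2 <;> ring
  rw [h2] at h1
  have h3 := le_of_mul_le_mul_right h1 (by positivity)
  refine le_trans ?_ h3
  rw [← pow_mul]
  apply div_le_div_of_nonneg_left (by positivity) (by positivity)
  apply pow_le_pow_right₀ (by norm_num)
  nlinarith [sq_nonneg t]

open Classical in
lemma aux_count {β : Type} (P : Finset (Finset β)) (Q : Finset β → Finset (Finset β))
    (V : Finset β → Finset β → Finset (Finset β)) (a b c : ℝ) (hb : 0 ≤ b) (hc : 0 ≤ c)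
    (hP : a ≤ P.card) (hQ : ∀ A ∈ P, b ≤ (Q A).card) (hV : ∀ A ∈ P, ∀ B ∈ Q A, c ≤ (V A B).card) :
    a * (b * c) ≤ ((P.sigma (fun A => (Q A).sigma (fun B => V A B))).card : ℝ) := by
  rw [Finset.card_sigma]
  push_cast
  calc a * (b * c) ≤ P.card * (b*c) := by gcongr
    _ = ∑ A ∈ P, b * c := by simp
    _ ≤ _ := by
      apply Finset.sum_le_sum
      intro A hA
      rw [Finset.card_sigma]
      push_cast
      calc b * c ≤ (Q A).card * c := by have := hQ A hA; gcongr
        _ = ∑ B ∈ Q A, c := by simp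
        _ ≤ _ := Finset.sum_le_sum (fun B hB => hV A hA B hB)


open SimpleGraph Finset

/-- The number of graph homomorphisms from `H` to `G`. -/
noncomputable def homCount {α β : Type*} (H : SimpleGraph α) (G : SimpleGraph β) : ℕ :=
  Nat.card (H →g G)

/-- The `H`-density of `G`: the number of homomorphisms from `H` to `G`
divided by `|V(G)|^|V(H)|`. -/
noncomputable def homDensity {α β : Type*} [Fintype α] [Fintype β]
    (H : SimpleGraph α) (G : SimpleGraph β) : ℝ :=
  (homCount H G : ℝ) / (Fintype.card β : ℝ) ^ (Fintype.card α)

/-- The triangle `K₃`. -/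
def triangleGraph : SimpleGraph (Fin 3) := ⊤

/-- The complete tripartite graph `K_{a,b,c}`, the `(a,b,c)`-blowup of the triangle. -/
def Kabc (a b c : ℕ) : SimpleGraph (Σ i : Fin 3, Fin (![a, b, c] i)) :=
  completeMultipartiteGraph (fun i => Fin (![a, b, c] i))
/-- (Packing lemma) There is an absolute constant `C > 1` such that every
3-partite graph on parts `X, Y, Z` of equal size `m` with all three pairwise edge
densities at least `15/16` contains at least `⌊m^(3t)/C^(3t²)⌋` distinct copies of
`K_{t,t,t}`, i.e. triples `(S,T,U)` of `t`-element subsets of `X, Y, Z` with all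
cross pairs adjacent. -/
theorem packing_lemma :
    ∃ C : ℝ, 1 < C ∧ ∀ t : ℕ, 0 < t → ∀ m : ℕ,
      ∀ (β : Type) [Fintype β] (G : SimpleGraph β) [DecidableRel G.Adj]
        (X Y Z : Finset β),
        Disjoint X Y → Disjoint X Z → Disjoint Y Z →
        (∀ v : β, v ∈ X ∨ v ∈ Y ∨ v ∈ Z) →
        (∀ x ∈ X, ∀ y ∈ X, ¬ G.Adj x y) →
        (∀ x ∈ Y, ∀ y ∈ Y, ¬ G.Adj x y) →
        (∀ x ∈ Z, ∀ y ∈ Z, ¬ G.Adj x y) →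
        X.card = m → Y.card = m → Z.card = m →
        (15 / 16 : ℝ) ≤ (G.edgeDensity X Y : ℝ) →
        (15 / 16 : ℝ) ≤ (G.edgeDensity X Z : ℝ) →
        (15 / 16 : ℝ) ≤ (G.edgeDensity Y Z : ℝ) →
        ⌊(m : ℝ) ^ (3 * t) / C ^ (3 * t ^ 2)⌋₊ ≤
          Nat.card {p : Finset β × Finset β × Finset β //
            p.1 ⊆ X ∧ p.2.1 ⊆ Y ∧ p.2.2 ⊆ Z ∧
            p.1.card = t ∧ p.2.1.card = t ∧ p.2.2.card = t ∧
            (∀ x ∈ p.1, ∀ y ∈ p.2.1, G.Adj x y) ∧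
            (∀ x ∈ p.1, ∀ y ∈ p.2.2, G.Adj x y) ∧
            (∀ x ∈ p.2.1, ∀ y ∈ p.2.2, G.Adj x y)} := by
  classical
  refine ⟨2^124, by norm_num, ?_⟩
  intro t ht m β _ G _ X Y Z _ _ _ _ _ _ _ hX hY hZ hXY hXZ hYZ
  by_cases hsmall : (m : ℝ) ^ (3 * t) / ((2:ℝ)^124) ^ (3 * t ^ 2) < 1
  · rw [Nat.floor_eq_zero.2 hsmall]
    exact Nat.zero_le _
  have hbig : (2:ℝ)^(124*t) ≤ m := by
    rw [not_lt, le_div_iff₀ (by positivity), one_mul] at hsmall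
    have e : ((2:ℝ)^124) ^ (3 * t ^ 2) = ((2:ℝ)^(124*t))^(3*t) := by
      rw [← pow_mul, ← pow_mul]; congr 1; ring
    rw [e] at hsmall
    exact (pow_le_pow_iff_left₀ (by positivity) (by positivity) (by omega)).1 hsmall
  have hm' : (0:ℝ) < m := lt_of_lt_of_le (by positivity) hbig
  have hm : 0 < m := by exact_mod_cast hm'
  apply Nat.floor_le_of_le
  rw [Nat.card_eq_fintype_card, Fintype.card_subtype]
  set K := Finset.univ.filter (fun p : Finset β × Finset β × Finset β =>
            p.1 ⊆ X ∧ p.2.1 ⊆ Y ∧ p.2.2 ⊆ Z ∧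
            p.1.card = t ∧ p.2.1.card = t ∧ p.2.2.card = t ∧
            (∀ x ∈ p.1, ∀ y ∈ p.2.1, G.Adj x y) ∧
            (∀ x ∈ p.1, ∀ y ∈ p.2.2, G.Adj x y) ∧
            (∀ x ∈ p.2.1, ∀ y ∈ p.2.2, G.Adj x y)) with hK
  apply aux_arith _ m t ht hm
  have d1 := aux_dens G X Y m hm hX hY hXY
  have d2 := aux_dens G X Z m hm hX hZ hXZ
  have d3 := aux_dens G Y Z m hm hY hZ hYZ
  set X1 := X.filter (fun x => (m:ℝ)/4 < ((Y.filter (fun y => ¬ G.Adj x y)).card : ℕ)) with hX1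
  set X2 := X.filter (fun x => (m:ℝ)/4 < ((Z.filter (fun y => ¬ G.Adj x y)).card : ℕ)) with hX2
  set Y1 := Y.filter (fun x => (m:ℝ)/4 < ((Z.filter (fun y => ¬ G.Adj x y)).card : ℕ)) with hY1
  obtain ⟨X', hX'⟩ : ∃ X', X' = X \ (X1 ∪ X2) := ⟨_, rfl⟩
  obtain ⟨Y', hY'⟩ : ∃ Y', Y' = Y \ Y1 := ⟨_, rfl⟩
  have hX'X : X' ⊆ X := hX' ▸ Finset.sdiff_subset
  have hY'Y : Y' ⊆ Y := hY' ▸ Finset.sdiff_subset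
  have hX'c : (m:ℝ)/2 ≤ X'.card := by
    have h3 : X.card ≤ X'.card + (X1.card + X2.card) := by
      have := Finset.le_card_sdiff (X1 ∪ X2) X
      have := Finset.card_union_le X1 X2
      rw [hX']
      omega
    have h3' : (X.card:ℝ) ≤ X'.card + (X1.card + X2.card) := by exact_mod_cast h3
    rw [hX] at h3'
    linarith
  have hY'c : 3/4*(m:ℝ) ≤ Y'.card := by
    have h3 : Y.card ≤ Y'.card + Y1.card := by
      have := Finset.le_card_sdiff Y1 Y
      rw [hY']
      omega
    have h3' : (Y.card:ℝ) ≤ Y'.card + Y1.card := by exact_mod_cast h3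
    rw [hY] at h3'
    linarith
  have gXY : ∀ x ∈ X', ((Y'.filter (fun y => ¬ G.Adj x y)).card:ℝ) ≤ m/4 := by
    intro x hx
    rw [hX', Finset.mem_sdiff, Finset.mem_union, not_or, hX1, Finset.mem_filter] at hx
    have h1 : ((Y.filter (fun y => ¬ G.Adj x y)).card:ℝ) ≤ m/4 := by
      by_contra hc
      exact hx.2.1 ⟨hx.1, not_le.1 hc⟩
    refine le_trans ?_ h1
    exact_mod_cast Finset.card_le_card (Finset.filter_subset_filter _ hY'Y)
  have gXZ : ∀ x ∈ X', ((Z.filter (fun y => ¬ G.Adj x y)).card:ℝ) ≤ m/4 := by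
    intro x hx
    rw [hX', Finset.mem_sdiff, Finset.mem_union, not_or, hX2, Finset.mem_filter (s := X)] at hx
    by_contra hc
    exact hx.2.2 (Finset.mem_filter.2 ⟨hx.1, not_le.1 hc⟩)
  have gYZ : ∀ x ∈ Y', ((Z.filter (fun y => ¬ G.Adj x y)).card:ℝ) ≤ m/4 := by
    intro x hx
    rw [hY', Finset.mem_sdiff] at hx
    by_contra hc
    exact hx.2 (Finset.mem_filter.2 ⟨hx.1, not_le.1 hc⟩)
  have sA : ∀ A ∈ X'.powersetCard (16*t), ∃ S ⊆ A, S.card = 4 * t ∧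
      (m:ℝ)/2^(18*t) ≤ ((Y'.filter (fun w => ∀ a ∈ S, G.Adj a w)).card : ℝ) := by
    intro A hA
    rw [Finset.mem_powersetCard] at hA
    have hres := aux_stepA G.Adj A Y' t m ht hm hA.2 hY'c (fun a ha => by convert gXY a (hA.1 ha))
    convert hres
  choose! f hf1 hf2 hf3 using sA
  obtain ⟨Q, hQ⟩ : ∃ Q : Finset β → Finset (Finset β), Q = fun A => (Y'.filter (fun w => ∀ a ∈ f A, G.Adj a w)).powersetCard (4*t) := ⟨_, rfl⟩
  have sB : ∀ A ∈ X'.powersetCard (16*t), ∀ B ∈ Q A, ∃ p : Finset β × Finset β, p.1 ⊆ f A ∧ p.2 ⊆ B ∧ p.1.card = t ∧ p.2.card = t ∧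
      (m:ℝ)/2^(10*t) ≤ ((Z.filter (fun w => (∀ a ∈ p.1, G.Adj a w) ∧ ∀ a ∈ p.2, G.Adj a w)).card : ℝ) := by
    intro A hA B hB
    have hfA := hf1 A hA
    have hfc := hf2 A hA
    simp only [hQ, Finset.mem_powersetCard] at hA hB
    have hres := aux_stepB G.Adj (f A) B Z t m ht hm hfc hB.2 hZ (fun a ha => by convert gXZ a (hA.1 (hfA ha)))
      (fun b hb => by convert gYZ b (Finset.mem_filter.1 (hB.1 hb)).1)
    convert hres
  choose! p hp1 hp2 hp3 hp4 hp5 using sB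
  obtain ⟨V, hV⟩ : ∃ V : Finset β → Finset β → Finset (Finset β), V = fun A B => (Z.filter (fun w => (∀ a ∈ (p A B).1, G.Adj a w) ∧ ∀ a ∈ (p A B).2, G.Adj a w)).powersetCard t := ⟨_, rfl⟩
  have hpow : ∀ i j : ℕ, i + j ≤ 124*t → (2:ℝ)^i ≤ m/2^j := by
    intro i j hij
    rw [le_div_iff₀ (by positivity), ← pow_add]
    exact le_trans (pow_le_pow_right₀ (by norm_num) hij) hbig
  have hcount := aux_count (X'.powersetCard (16*t)) Q V (((m:ℝ)/2/2^(16*t))^(16*t)) (((m:ℝ)/2^(18*t)/2^(4*t))^(4*t))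
    (((m:ℝ)/2^(10*t)/2^t)^t) (by positivity) (by positivity)
    (by
      rw [Finset.card_powersetCard]
      refine aux_choose _ _ _ (by omega) ?_ hX'c
      simpa using hpow (16*t) 1 (by omega))
    (by
      intro A hA
      rw [hQ, Finset.card_powersetCard]
      exact aux_choose _ _ _ (by omega) (hpow _ _ (by omega)) (hf3 A hA))
    (by
      intro A hA B hB
      rw [hV, Finset.card_powersetCard]
      exact aux_choose _ _ _ (by omega) (hpow _ _ (by omega)) (hp5 A hA B hB))
  refine hcount.trans ?_
  have hinj : ((X'.powersetCard (16*t)).sigma (fun A => (Q A).sigma (fun B => V A B))).card ≤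
      (K ×ˢ (X.powersetCard (15*t) ×ˢ Y.powersetCard (3*t))).card := by
    apply Finset.card_le_card_of_injOn
      (fun q => (((p q.1 q.2.1).1, (p q.1 q.2.1).2, q.2.2), (q.1 \ (p q.1 q.2.1).1, q.2.1 \ (p q.1 q.2.1).2)))
    · rintro ⟨A, B, U⟩ hq
      simp only [Finset.coe_sigma, Set.mem_sigma_iff, Finset.mem_coe] at hq
      obtain ⟨hA, hB, hU⟩ := hq
      have k1 := hp1 A hA B hB
      have k2 := hp2 A hA B hB
      have k3 := hp3 A hA B hB
      have k4 := hp4 A hA B hB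
      have k5 := hf1 A hA
      simp only [hQ, hV, Finset.mem_powersetCard] at hA hB hU
      have hBY : B ⊆ Y := fun b hb => hY'Y (Finset.mem_filter.1 (hB.1 hb)).1
      have hAX : A ⊆ X := hA.1.trans hX'X
      simp only [Finset.mem_coe, Finset.mem_product, hK, Finset.mem_filter, Finset.mem_univ, true_and, Finset.mem_powersetCard]
      refine ⟨⟨(k1.trans k5).trans hAX, k2.trans hBY, fun u hu => (Finset.mem_filter.1 (hU.1 hu)).1, k3, k4, hU.2, ?_, ?_, ?_⟩, ⟨Finset.sdiff_subset.trans hAX, ?_⟩, ⟨Finset.sdiff_subset.trans hBY, ?_⟩⟩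
      · intro x hx y hy
        exact (Finset.mem_filter.1 (hB.1 (k2 hy))).2 x (k1 hx)
      · intro x hx y hy
        exact (Finset.mem_filter.1 (hU.1 hy)).2.1 x hx
      · intro x hx y hy
        exact (Finset.mem_filter.1 (hU.1 hy)).2.2 x hx
      · rw [Finset.card_sdiff_of_subset (k1.trans k5)]; omega
      · rw [Finset.card_sdiff_of_subset k2]; omega
    · rintro ⟨A, B, U⟩ hq ⟨A', B', U'⟩ hq' heq
      simp only [Finset.coe_sigma, Set.mem_sigma_iff, Finset.mem_coe] at hq hq'
      obtain ⟨hA, hB, hU⟩ := hq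
      obtain ⟨hA', hB', hU'⟩ := hq'
      simp only [Prod.mk.injEq] at heq
      obtain ⟨⟨e1, e2, e3⟩, e4, e5⟩ := heq
      have r1 : A = A' := by
        rw [← Finset.sdiff_union_of_subset ((hp1 A hA B hB).trans (hf1 A hA)), e4, e1,
          Finset.sdiff_union_of_subset ((hp1 A' hA' B' hB').trans (hf1 A' hA'))]
      have r2 : B = B' := by
        rw [← Finset.sdiff_union_of_subset (hp2 A hA B hB), e5, e2,
          Finset.sdiff_union_of_subset (hp2 A' hA' B' hB')]
      rw [r1, r2, e3]
  rw [Finset.card_product, Finset.card_product, Finset.card_powersetCard, Finset.card_powersetCard, hX, hY] at hinj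
  have hfin := hinj.trans (Nat.mul_le_mul_left K.card (Nat.mul_le_mul (Nat.choose_le_pow m (15*t)) (Nat.choose_le_pow m (3*t))))
  exact_mod_cast hfin
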